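/- Quadratic form comparability for the Lax operator (deep-water case): there exists a constant C ≥ 1 such that for every β ∈ {−1, 1}, every Schwartz function u : ℝ → ℂ, and every real κ with κ ≥ C(1 + ‖u‖_{H^{1/4}})⁴, where ‖u‖_{H^{1/4}} := ( ∫_ℝ (1+ξ²)^{1/4} |û(ξ)|² dξ )^{1/2}, the following holds for every Schwartz function f : ℝ → ℂ: (1/2)( ‖f′‖_{L²}² + κ² ‖f‖_{L²}² ) ≤ ‖ −i f′ + β·u·P₊(conj(u)·f) ‖_{L²}² + κ² ‖f‖_{L²}² ≤ (3/2)( ‖f′‖_{L²}² + κ² ‖f‖_{L²}² ). -/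

import Mathlib

open MeasureTheory Complex

/-- The Fourier transform, normalized as `ĝ(ξ) = (2π)^{-1/2} ∫ g(y) e^{-iyξ} dy`. -/
noncomputable def FT (f : ℝ → ℂ) (ξ : ℝ) : ℂ :=
  (Real.sqrt (2 * Real.pi))⁻¹ • ∫ x : ℝ, f x * Complex.exp (-(Complex.I * x * ξ))

/-- The positive-frequency (Szegő) projection
`(P₊g)(x) = (2π)^{-1/2} ∫_0^∞ ĝ(ξ) e^{ixξ} dξ`. -/
noncomputable def Pplus (g : ℝ → ℂ) (x : ℝ) : ℂ :=
  (Real.sqrt (2 * Real.pi))⁻¹ • ∫ ξ in Set.Ioi (0 : ℝ), FT g ξ * Complex.exp (Complex.I * x * ξ)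


open scoped ENNReal FourierTransform SchwartzMap

lemma FT_eq (g : ℝ → ℂ) (t : ℝ) : FT g (2 * Real.pi * t) = (Real.sqrt (2 * Real.pi))⁻¹ • 𝓕 g t := by
  rw [FT, Real.fourier_real_eq_integral_exp_smul]
  congr 2
  ext x
  rw [smul_eq_mul, mul_comm]
  congr 2
  push_cast
  ring

lemma Pplus_eq (g : ℝ → ℂ) (x : ℝ) : Pplus g x = 𝓕⁻ ((Set.Ioi (0:ℝ)).indicator (𝓕 g)) x := by
  have hpi : 0 < 2 * Real.pi := by positivity
  have h := integral_comp_mul_left_Ioi' (fun ξ : ℝ => FT g ξ * Complex.exp (Complex.I * x * ξ)) 0 hpi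
  rw [mul_zero] at h
  rw [Pplus, ← h, Real.fourierInv_eq']
  have e : ∀ v : ℝ, cexp (↑(2 * Real.pi * inner ℝ v x) * I) • (Set.Ioi (0:ℝ)).indicator (𝓕 g) v
      = (Set.Ioi (0:ℝ)).indicator (fun v : ℝ => cexp (↑(2 * Real.pi * inner ℝ v x) * I) • 𝓕 g v) v := by
    intro v
    by_cases hv : v ∈ Set.Ioi (0:ℝ)
    · simp [hv]
    · simp [hv]
  simp_rw [e]
  rw [integral_indicator measurableSet_Ioi, smul_smul, ← integral_smul]
  refine setIntegral_congr_fun measurableSet_Ioi fun v hv => ?_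
  simp only [FT_eq, smul_eq_mul, real_smul]
  have hs : ((Real.sqrt (2 * Real.pi) : ℝ) : ℂ) * (Real.sqrt (2 * Real.pi) : ℝ) = 2 * Real.pi := by
    rw [← ofReal_mul, Real.mul_self_sqrt hpi.le]; push_cast; rfl
  have hs0 : ((Real.sqrt (2 * Real.pi) : ℝ) : ℂ) ≠ 0 := by
    rw [ofReal_ne_zero]; positivity
  have e2 : Complex.I * x * ((2 * Real.pi * v : ℝ) : ℂ) = ((2 * Real.pi * inner ℝ v x : ℝ) : ℂ) * I := by
    simp; ring
  rw [e2]
  push_cast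
  rw [← hs]
  field_simp

lemma sesq (f g : ℝ → ℂ) (hf : Integrable f) (hg : Integrable g) :
    ∫ ξ, (starRingEnd ℂ) (𝓕 f ξ) * g ξ = ∫ x, (starRingEnd ℂ) (f x) * 𝓕⁻ g x := by
  have := VectorFourier.integral_sesq_fourierIntegral_eq_neg_flip (innerSL ℂ (E := ℂ))
    (L := innerₗ ℝ) Real.continuous_fourierChar continuous_inner hf hg
  simp only [innerSL_apply_apply, RCLike.inner_apply] at this
  simp_rw [mul_comm ((starRingEnd ℂ) _)]
  simpa using! this

noncomputable def cmul (u f : 𝓢(ℝ, ℂ)) : 𝓢(ℝ, ℂ) :=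
  SchwartzMap.pairing (ContinuousLinearMap.mul ℝ ℂ) (SchwartzMap.postcompCLM (conjCLE.toContinuousLinearMap) u) f

lemma cmul_apply (u f : 𝓢(ℝ, ℂ)) (x : ℝ) : cmul u f x = (starRingEnd ℂ) (u x) * f x := by
  simp [cmul, SchwartzMap.pairing_apply_apply]

lemma fourier_cmul (u f : 𝓢(ℝ, ℂ)) (η : ℝ) :
    𝓕 (cmul u f) η = ∫ ζ, (starRingEnd ℂ) (𝓕 u (ζ - η)) * 𝓕 f ζ := by
  have h := sesq (fun x => cexp (↑(2 * Real.pi * x * η) * I) * u x) (⇑(𝓕 f : 𝓢(ℝ, ℂ))) (by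
    apply u.integrable.bdd_mul (c := 1)
    · exact (by fun_prop : Continuous _).aestronglyMeasurable
    · refine Filter.Eventually.of_forall fun x => ?_
      rw [norm_exp_ofReal_mul_I]) (𝓕 f).integrable
  have e1 : 𝓕⁻ (⇑(𝓕 f : 𝓢(ℝ, ℂ))) = ⇑f := by
    rw [← SchwartzMap.fourierInv_coe]; simp
  rw [e1] at h
  have e2 : ∀ ζ, 𝓕 (fun x => cexp (↑(2 * Real.pi * x * η) * I) * u x) ζ = 𝓕 u (ζ - η) := by
    intro ζ
    rw [SchwartzMap.fourier_coe, Real.fourier_real_eq_integral_exp_smul, Real.fourier_real_eq_integral_exp_smul]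
    congr 1
    ext x
    rw [smul_eq_mul, smul_eq_mul, ← mul_assoc, ← Complex.exp_add]
    congr 2
    push_cast
    ring
  simp_rw [e2] at h
  rw [h, SchwartzMap.fourier_coe, Real.fourier_real_eq_integral_exp_smul]
  congr 1
  ext x
  rw [cmul_apply, map_mul, ← Complex.exp_conj, smul_eq_mul, map_mul, conj_I, conj_ofReal]
  rw [show ((-2 * Real.pi * x * η : ℝ) : ℂ) * I = ((2 * Real.pi * x * η : ℝ) : ℂ) * -I by push_cast; ring]
  ring

/-- the dual pairing -/
lemma pair_eq (u f φ : 𝓢(ℝ, ℂ)) :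
    ∫ x, (starRingEnd ℂ) (φ x) * (u x * Pplus (fun y => (starRingEnd ℂ) (u y) * f y) x) =
      ∫ η, (starRingEnd ℂ) (𝓕 (cmul u φ) η) * (Set.Ioi (0:ℝ)).indicator (⇑(𝓕 (cmul u f) : 𝓢(ℝ, ℂ))) η := by
  have h := sesq (cmul u φ) ((Set.Ioi (0:ℝ)).indicator (⇑(𝓕 (cmul u f) : 𝓢(ℝ, ℂ)))) (cmul u φ).integrable
    ((𝓕 (cmul u f)).integrable.indicator measurableSet_Ioi)
  rw [SchwartzMap.fourier_coe, h]
  congr 1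
  ext x
  have : (fun y => (starRingEnd ℂ) (u y) * f y) = cmul u f := by
    ext y; rw [cmul_apply]
  rw [this, Pplus_eq, cmul_apply, map_mul, conj_conj, SchwartzMap.fourier_coe]
  ring

lemma Pplus_bdd (g : 𝓢(ℝ, ℂ)) : Continuous (Pplus g) ∧ ∃ C, ∀ x, ‖Pplus g x‖ ≤ C := by
  have hi : Integrable ((Set.Ioi (0:ℝ)).indicator (⇑(𝓕 g : 𝓢(ℝ, ℂ)))) := (𝓕 g).integrable.indicator measurableSet_Ioi
  have e : Pplus g = 𝓕⁻ ((Set.Ioi (0:ℝ)).indicator (𝓕 (g : ℝ → ℂ))) := by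
    ext x; exact Pplus_eq g x
  rw [e]
  rw [SchwartzMap.fourier_coe] at hi
  constructor
  · rw [Real.fourierInv_eq_fourier_comp_neg]
    exact VectorFourier.fourierIntegral_continuous Real.continuous_fourierChar
      (innerSL ℝ).continuous₂ hi.comp_neg
  · refine ⟨∫ x, ‖(Set.Ioi (0:ℝ)).indicator (𝓕 (g : ℝ → ℂ)) x‖, fun x => ?_⟩
    rw [Real.fourierInv_eq]
    apply (norm_integral_le_integral_norm _).trans
    simp_rw [Circle.norm_smul]
    exact le_rfl

lemma aux_lint (r : ℝ) : ∫⁻ b : ℝ, (if |b| ≤ |r| then ‖b‖ₑ ^ (-(1/2) : ℝ) else 0) ≤ 4 * ‖r‖ₑ ^ (1/2 : ℝ) := by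
  have h0 : ∀ s : ℝ, 0 ≤ s → ∫⁻ b in Set.Ioc 0 s, ‖b‖ₑ ^ (-(1/2) : ℝ) = 2 * ENNReal.ofReal (s ^ (1/2:ℝ)) := by
    intro s hs
    have h1 : IntegrableOn (fun b : ℝ => b ^ (-(1/2) : ℝ)) (Set.Ioc 0 s) := by
      have := intervalIntegral.intervalIntegrable_rpow' (a := 0) (b := s) (r := -(1/2)) (by norm_num)
      rwa [intervalIntegrable_iff_integrableOn_Ioc_of_le hs] at this
    have h2 : ∫⁻ b in Set.Ioc 0 s, ‖b‖ₑ ^ (-(1/2) : ℝ) = ∫⁻ b in Set.Ioc 0 s, ENNReal.ofReal (b ^ (-(1/2) : ℝ)) := by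
      refine setLIntegral_congr_fun measurableSet_Ioc fun b hb => ?_
      rw [← ENNReal.ofReal_rpow_of_pos hb.1, Real.enorm_eq_ofReal hb.1.le]
    rw [h2, ← ofReal_integral_eq_lintegral_ofReal h1]
    · rw [← intervalIntegral.integral_of_le hs, integral_rpow (Or.inl (by norm_num))]
      rw [show (2:ℝ≥0∞) = ENNReal.ofReal 2 by simp, ← ENNReal.ofReal_mul (by norm_num)]
      congr 1
      norm_num
      ring
    · filter_upwards [ae_restrict_mem measurableSet_Ioc] with b hb
      exact Real.rpow_nonneg hb.1.le _
  set F : ℝ → ℝ≥0∞ := fun b => (Set.Ioc 0 |r|).indicator (fun b : ℝ => ‖b‖ₑ ^ (-(1/2) : ℝ)) b with hF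
  have hFm : Measurable F := by
    apply Measurable.indicator _ measurableSet_Ioc
    fun_prop
  have hFi : ∫⁻ b, F b = 2 * ‖r‖ₑ ^ (1/2 : ℝ) := by
    rw [hF, lintegral_indicator measurableSet_Ioc, h0 _ (abs_nonneg r), ← Real.enorm_abs, 
      Real.enorm_eq_ofReal (abs_nonneg r), ENNReal.ofReal_rpow_of_nonneg (abs_nonneg r) (by norm_num)]
  have hFn : ∫⁻ b, F (-b) = 2 * ‖r‖ₑ ^ (1/2 : ℝ) := by
    rw [← hFi]; exact (Measure.measurePreserving_neg (volume : Measure ℝ)).lintegral_comp hFm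
  calc _ ≤ ∫⁻ b, (F b + F (-b)) := by
        apply lintegral_mono_ae
        have : ∀ᵐ b : ℝ, b ≠ 0 := by simp [ae_iff, measure_singleton]
        filter_upwards [this] with b hb
        split_ifs with h
        · rcases lt_or_gt_of_ne hb with h' | h'
          · have : -b ∈ Set.Ioc 0 |r| := ⟨by linarith, by rwa [abs_of_neg h'] at h⟩
            simp [hF, Set.indicator_of_mem this]
          · have : b ∈ Set.Ioc 0 |r| := ⟨by linarith, by rwa [abs_of_pos h'] at h⟩
            simp [hF, Set.indicator_of_mem this]
        · simp
    _ = _ := by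
      rw [lintegral_add_left hFm, hFi, hFn]; ring

lemma aux_half (v : ℝ → ℝ≥0∞) (hv : Measurable v) (k : ℝ × ℝ → ℝ≥0∞)
    (hk : Measurable k) (G : ℝ≥0∞) (hG : ∀ b, ∫⁻ a, k (a, b) ^ 2 ≤ G) :
    ∫⁻ p : ℝ × ℝ, (if |p.2| ≤ |p.1| then v p.1 * v p.2 * k p else 0) ≤
      2 * (∫⁻ a, v a ^ 2 * ‖a‖ₑ ^ (1/2 : ℝ)) * G ^ (1/2 : ℝ) := by
  set H := ∫⁻ a, v a ^ 2 * ‖a‖ₑ ^ (1/2 : ℝ) with hH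
  set A : ℝ × ℝ → ℝ≥0∞ := fun p => v p.2 * ‖p.2‖ₑ ^ (1/4 : ℝ) * k p with hA
  set B : ℝ × ℝ → ℝ≥0∞ := fun p => v p.1 * (if |p.2| ≤ |p.1| then ‖p.2‖ₑ ^ (-(1/4) : ℝ) else 0) with hB
  have hset : MeasurableSet {p : ℝ × ℝ | |p.2| ≤ |p.1|} :=
    measurableSet_le (by fun_prop) (by fun_prop)
  have hAm : Measurable A := by fun_prop
  have hBm : Measurable B := by
    apply Measurable.mul (by fun_prop)
    exact Measurable.ite hset (by fun_prop) (by fun_prop)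
  have hAB := ENNReal.lintegral_mul_le_Lp_mul_Lq (volume : Measure (ℝ × ℝ)) Real.HolderConjugate.two_two
    hAm.aemeasurable hBm.aemeasurable
  have pw : ∀ t : ℝ≥0∞, (t ^ (1/4 : ℝ)) ^ 2 = t ^ (1/2 : ℝ) := fun t => by
    rw [← ENNReal.rpow_natCast, ← ENNReal.rpow_mul]; norm_num
  have pw' : ∀ t : ℝ≥0∞, (t ^ (-(1/4) : ℝ)) ^ 2 = t ^ (-(1/2) : ℝ) := fun t => by
    rw [← ENNReal.rpow_natCast, ← ENNReal.rpow_mul]; norm_num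
  have h1 : ∫⁻ p, A p ^ (2:ℝ) ≤ H * G := by
    rw [Measure.volume_eq_prod, lintegral_prod_symm _ (hAm.pow_const _).aemeasurable]
    calc _ = ∫⁻ b, v b ^ 2 * ‖b‖ₑ ^ (1/2 : ℝ) * ∫⁻ a, k (a, b) ^ 2 := by
          refine lintegral_congr fun b => ?_
          rw [← lintegral_const_mul _ (by fun_prop)]
          refine lintegral_congr fun a => ?_
          simp only [hA]
          rw [ENNReal.rpow_two, mul_pow, mul_pow, pw]
      _ ≤ ∫⁻ b, v b ^ 2 * ‖b‖ₑ ^ (1/2 : ℝ) * G := by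
          gcongr with b
          exact hG b
      _ = _ := by rw [lintegral_mul_const _ (by fun_prop)]
  have h2 : ∫⁻ p, B p ^ (2:ℝ) ≤ 4 * H := by
    rw [Measure.volume_eq_prod, lintegral_prod _ (hBm.pow_const _).aemeasurable]
    calc _ = ∫⁻ a, v a ^ 2 * ∫⁻ b, (if |b| ≤ |a| then ‖b‖ₑ ^ (-(1/2) : ℝ) else 0) := by
          refine lintegral_congr fun a => ?_
          rw [← lintegral_const_mul]
          · refine lintegral_congr fun b => ?_
            simp only [hB]
            rw [ENNReal.rpow_two, mul_pow]
            split_ifs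
            · rw [pw']
            · simp
          · exact Measurable.ite (measurableSet_le (by fun_prop) (by fun_prop)) (by fun_prop) (by fun_prop)
      _ ≤ ∫⁻ a, v a ^ 2 * (4 * ‖a‖ₑ ^ (1/2 : ℝ)) := by
          gcongr with a
          exact aux_lint a
      _ = _ := by 
          rw [hH, ← lintegral_const_mul _ (by fun_prop)]
          refine lintegral_congr fun a => ?_
          ring
  calc _ = ∫⁻ p, (A * B) p := by
        apply lintegral_congr_ae
        have : ∀ᵐ p : ℝ × ℝ, p.2 ≠ 0 := by
          rw [Measure.volume_eq_prod]
          have : ∀ᵐ b : ℝ, b ≠ 0 := by simp [ae_iff, measure_singleton]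
          exact Measure.quasiMeasurePreserving_snd.ae this
        filter_upwards [this] with p hp
        simp only [hA, hB, Pi.mul_apply]
        split_ifs
        · have : ‖p.2‖ₑ ^ (1/4 : ℝ) * ‖p.2‖ₑ ^ (-(1/4) : ℝ) = 1 := by
            rw [← ENNReal.rpow_add _ _ (by simpa using hp) (by simp)]; simp
          calc _ = v p.1 * v p.2 * k p * (‖p.2‖ₑ ^ (1/4 : ℝ) * ‖p.2‖ₑ ^ (-(1/4) : ℝ)) := by rw [this, mul_one]
            _ = _ := by ring
        · simp
    _ ≤ _ := hAB
    _ ≤ (H * G) ^ (1/2:ℝ) * (4 * H) ^ (1/2:ℝ) := by gcongr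
    _ = _ := by
      rw [ENNReal.mul_rpow_of_nonneg _ _ (by norm_num), ENNReal.mul_rpow_of_nonneg _ _ (by norm_num)]
      have e1 : (4:ℝ≥0∞) ^ (1/2:ℝ) = 2 := by
        rw [show (4:ℝ≥0∞) = 2 ^ (2:ℝ) by norm_num, ← ENNReal.rpow_mul]; norm_num
      have e2 : H ^ (1/2:ℝ) * H ^ (1/2:ℝ) = H := by
        rw [← ENNReal.rpow_add_of_nonneg _ _ (by norm_num) (by norm_num)]; norm_num
      rw [e1]
      calc _ = 2 * (H ^ (1/2:ℝ) * H ^ (1/2:ℝ)) * G ^ (1/2:ℝ) := by ring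
        _ = _ := by rw [e2]

lemma aux_full (v g : ℝ → ℝ≥0∞) (hv : Measurable v) (hg : Measurable g) (ζ : ℝ) :
    ∫⁻ η, ∫⁻ ξ, v (ζ - η) * (v (ξ - η) * g ξ) ≤
      4 * (∫⁻ a, v a ^ 2 * ‖a‖ₑ ^ (1/2 : ℝ)) * (∫⁻ a, g a ^ 2) ^ (1/2 : ℝ) := by
  set H := ∫⁻ a, v a ^ 2 * ‖a‖ₑ ^ (1/2 : ℝ) with hH
  set G := ∫⁻ a, g a ^ 2 with hGd
  have k1 := aux_half v hv (fun p => g (p.1 + (ζ - p.2))) (by fun_prop) G (fun b => by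
    rw [hGd]; exact (lintegral_add_right_eq_self (fun x => g x ^ 2) (ζ - b)).le)
  have k2 := aux_half v hv (fun p => g (p.2 + (ζ - p.1))) (by fun_prop) G (fun b => by
    simp only
    rw [show (fun a => g (b + (ζ - a)) ^ 2) = fun a => g ((b + ζ) - a) ^ 2 by
      ext a; ring_nf]
    rw [hGd]; exact (lintegral_sub_left_eq_self (fun x => g x ^ 2) (b + ζ)).le)
  have hset : MeasurableSet {p : ℝ × ℝ | |p.2| ≤ |p.1|} :=
    measurableSet_le (by fun_prop) (by fun_prop)
  have k2' : ∫⁻ p : ℝ × ℝ, (if |p.1| ≤ |p.2| then v p.1 * v p.2 * g (p.1 + (ζ - p.2)) else 0) ≤ 2 * H * G ^ (1/2:ℝ) := by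
    refine le_trans (le_of_eq ?_) k2
    rw [Measure.volume_eq_prod, ← lintegral_prod_swap]
    refine lintegral_congr fun p => ?_
    simp [mul_comm]
  calc _ = ∫⁻ b, ∫⁻ a, v a * v b * g (a + (ζ - b)) := by
        rw [← lintegral_sub_left_eq_self _ ζ]
        refine lintegral_congr fun b => ?_
        rw [← lintegral_add_right_eq_self _ (ζ - b)]
        refine lintegral_congr fun a => ?_
        simp only [sub_sub_cancel, add_sub_cancel_right]
        ring
    _ = ∫⁻ p : ℝ × ℝ, v p.1 * v p.2 * g (p.1 + (ζ - p.2)) := by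
        rw [Measure.volume_eq_prod, lintegral_prod_symm _ (by fun_prop)]
    _ ≤ ∫⁻ p : ℝ × ℝ, ((if |p.2| ≤ |p.1| then v p.1 * v p.2 * g (p.1 + (ζ - p.2)) else 0) + 
          (if |p.1| ≤ |p.2| then v p.1 * v p.2 * g (p.1 + (ζ - p.2)) else 0)) := by
        refine lintegral_mono fun p => ?_
        rcases le_total |p.2| |p.1| with h | h
        · simp only [if_pos h]; exact le_self_add
        · simp only [if_pos h]; exact le_add_self
    _ ≤ 2 * H * G ^ (1/2:ℝ) + 2 * H * G ^ (1/2:ℝ) := by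
        rw [lintegral_add_left (Measurable.ite hset (by fun_prop) (by fun_prop))]
        gcongr
    _ = _ := by ring

lemma aux_tri (v g w : ℝ → ℝ≥0∞) (hv : Measurable v) (hg : Measurable g) (hw : Measurable w) :
    ∫⁻ η, (∫⁻ ζ, v (ζ - η) * w ζ) * (∫⁻ ξ, v (ξ - η) * g ξ) ≤
      4 * (∫⁻ a, v a ^ 2 * ‖a‖ₑ ^ (1/2 : ℝ)) * (∫⁻ a, g a ^ 2) ^ (1/2 : ℝ) * ∫⁻ ζ, w ζ := by
  calc _ = ∫⁻ η, ∫⁻ ζ, w ζ * ∫⁻ ξ, v (ζ - η) * (v (ξ - η) * g ξ) := by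
        refine lintegral_congr fun η => ?_
        rw [← lintegral_mul_const _ (by fun_prop)]
        refine lintegral_congr fun ζ => ?_
        rw [lintegral_const_mul _ (by fun_prop)]
        ring
    _ = ∫⁻ ζ, w ζ * ∫⁻ η, ∫⁻ ξ, v (ζ - η) * (v (ξ - η) * g ξ) := by
        rw [lintegral_lintegral_swap]
        · refine lintegral_congr fun ζ => ?_
          rw [lintegral_const_mul]
          apply Measurable.lintegral_prod_right
          fun_prop
        · apply Measurable.aemeasurable
          apply Measurable.mul (by fun_prop)
          apply Measurable.lintegral_prod_right' (f := fun q : (ℝ × ℝ) × ℝ => v (q.1.2 - q.1.1) * (v (q.2 - q.1.1) * g q.2))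
          fun_prop
    _ ≤ ∫⁻ ζ, w ζ * (4 * (∫⁻ a, v a ^ 2 * ‖a‖ₑ ^ (1/2 : ℝ)) * (∫⁻ a, g a ^ 2) ^ (1/2 : ℝ)) := by
        gcongr with ζ
        exact aux_full v g hv hg ζ
    _ = _ := by rw [lintegral_mul_const _ hw, mul_comm]

lemma pair_bound (u f φ : 𝓢(ℝ, ℂ)) :
    ‖∫ x, (starRingEnd ℂ) (φ x) * (u x * Pplus (fun y => (starRingEnd ℂ) (u y) * f y) x)‖ₑ ≤
      4 * (∫⁻ a, ‖𝓕 u a‖ₑ ^ 2 * ‖a‖ₑ ^ (1/2 : ℝ)) * (∫⁻ a, ‖𝓕 φ a‖ₑ ^ 2) ^ (1/2 : ℝ)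
        * ∫⁻ ζ, ‖𝓕 f ζ‖ₑ := by
  rw [pair_eq]
  have hm : ∀ g : 𝓢(ℝ, ℂ), Measurable (fun a => ‖𝓕 g a‖ₑ) := fun g =>
    (𝓕 g).continuous.enorm.measurable
  have hc : ∀ g : 𝓢(ℝ, ℂ), ∀ η, ‖𝓕 (cmul u g) η‖ₑ ≤ ∫⁻ ζ, ‖𝓕 u (ζ - η)‖ₑ * ‖𝓕 g ζ‖ₑ := by
    intro g η
    rw [fourier_cmul]
    refine (enorm_integral_le_lintegral_enorm _).trans (le_of_eq ?_)
    refine lintegral_congr fun ζ => ?_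
    rw [enorm_mul, RCLike.enorm_conj]
  refine (enorm_integral_le_lintegral_enorm _).trans ?_
  refine le_trans ?_ (aux_tri (fun a => ‖𝓕 u a‖ₑ) (fun a => ‖𝓕 φ a‖ₑ) (fun a => ‖𝓕 f a‖ₑ) (hm u) (hm φ) (hm f))
  refine lintegral_mono fun η => ?_
  rw [enorm_mul, RCLike.enorm_conj, mul_comm]
  refine mul_le_mul' (le_trans ?_ (hc f η)) (hc φ η)
  exact enorm_indicator_le_enorm_self _ _

lemma S_eq (u : 𝓢(ℝ, ℂ)) : ∫ ξ : ℝ, (1 + ξ ^ 2) ^ (1/4 : ℝ) * ‖FT (⇑u) ξ‖ ^ 2 =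
    ∫ t : ℝ, (1 + (2 * Real.pi * t) ^ 2) ^ (1/4 : ℝ) * ‖𝓕 u t‖ ^ 2 := by
  have hpi : 0 < 2 * Real.pi := by positivity
  have h := Measure.integral_comp_mul_left (fun ξ : ℝ => (1 + ξ ^ 2) ^ (1/4 : ℝ) * ‖FT (⇑u) ξ‖ ^ 2) (2 * Real.pi)
  rw [abs_of_pos (inv_pos.2 hpi), eq_comm, inv_smul_eq_iff₀ hpi.ne', ← integral_smul] at h
  rw [h]
  congr 1
  ext t
  rw [FT_eq, norm_smul, SchwartzMap.fourier_coe, mul_pow ‖_‖, Real.norm_eq_abs, sq_abs, inv_pow, Real.sq_sqrt hpi.le, smul_eq_mul]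
  field_simp

lemma S_bound (u : 𝓢(ℝ, ℂ)) : ∫⁻ a, ‖𝓕 u a‖ₑ ^ 2 * ‖a‖ₑ ^ (1/2 : ℝ) ≤
    ENNReal.ofReal (∫ ξ : ℝ, (1 + ξ ^ 2) ^ (1/4 : ℝ) * ‖FT (⇑u) ξ‖ ^ 2) := by
  rw [S_eq]
  have hw : ∀ t : ℝ, 0 ≤ (1 + (2 * Real.pi * t) ^ 2) ^ (1/4 : ℝ) := fun t => by positivity
  rw [ofReal_integral_eq_lintegral_ofReal]
  · refine lintegral_mono fun t => ?_
    rw [ENNReal.ofReal_mul (hw t), mul_comm, ← ofReal_norm, ← ofReal_norm, ENNReal.ofReal_pow (norm_nonneg _)]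
    gcongr
    rw [ENNReal.ofReal_rpow_of_nonneg (norm_nonneg _) (by norm_num)]
    apply ENNReal.ofReal_le_ofReal
    have : ‖t‖ ^ (1/2 : ℝ) = (‖t‖ ^ (2:ℝ)) ^ (1/4 : ℝ) := by
      rw [← Real.rpow_mul (norm_nonneg _)]; norm_num
    rw [this]
    apply Real.rpow_le_rpow (by positivity) _ (by norm_num)
    rw [Real.rpow_two, Real.norm_eq_abs, sq_abs, mul_pow]
    have : 1 ≤ (2 * Real.pi) ^ 2 := by nlinarith [Real.pi_gt_three]
    nlinarith [sq_nonneg t]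
  · obtain ⟨M, hM⟩ : ∃ M, ∀ t, ‖𝓕 u t‖ ≤ M := ⟨_, fun t => SchwartzMap.norm_le_seminorm ℝ (𝓕 u) t⟩
    have hi := ((𝓕 u).integrable.norm.const_mul M).add (((𝓕 u).integrable_pow_mul volume 2).const_mul (M * (2 * Real.pi) ^ 2))
    refine hi.mono' ?_ ?_
    · apply Continuous.aestronglyMeasurable
      apply Continuous.mul
      · exact Continuous.rpow_const (by fun_prop) (fun t => Or.inr (by norm_num))
      · exact (𝓕 u).continuous.norm.pow 2
    · refine Filter.Eventually.of_forall fun t => ?_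
      rw [Real.norm_of_nonneg (by positivity)]
      have h1 : (1 + (2 * Real.pi * t) ^ 2) ^ (1/4 : ℝ) ≤ 1 + (2 * Real.pi * t) ^ 2 := by
        conv_rhs => rw [← Real.rpow_one (1 + (2 * Real.pi * t) ^ 2)]
        apply Real.rpow_le_rpow_of_exponent_le _ (by norm_num)
        nlinarith [sq_nonneg (2 * Real.pi * t)]
      calc _ ≤ (1 + (2 * Real.pi * t) ^ 2) * (M * ‖𝓕 u t‖) := by
            rw [sq ‖_‖]; gcongr; exact hM t
        _ = _ := by
            simp only [Pi.add_apply, Real.norm_eq_abs, sq_abs]; ring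
  · exact Filter.Eventually.of_forall fun t => by positivity

lemma inv_int (κ : ℝ) (hκ : 0 < κ) : Integrable (fun t : ℝ => (κ ^ 2 + (2 * Real.pi * t) ^ 2)⁻¹) ∧
    ∫ t : ℝ, (κ ^ 2 + (2 * Real.pi * t) ^ 2)⁻¹ = 1 / (2 * κ) := by
  have e : (fun t : ℝ => (κ ^ 2 + (2 * Real.pi * t) ^ 2)⁻¹) =
      fun t => (κ ^ 2)⁻¹ * (1 + ((2 * Real.pi / κ) * t) ^ 2)⁻¹ := by
    ext t
    rw [← mul_inv]; congr 1; field_simp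
  have hne : 2 * Real.pi / κ ≠ 0 := by positivity
  rw [e]
  constructor
  · exact (integrable_inv_one_add_sq.comp_mul_left' hne).const_mul _
  · rw [integral_const_mul, Measure.integral_comp_mul_left (fun x : ℝ => (1 + x ^ 2)⁻¹), integral_univ_inv_one_add_sq,
      abs_of_pos (by positivity), smul_eq_mul]
    have := Real.pi_pos
    field_simp

lemma L1_bound (f : 𝓢(ℝ, ℂ)) (κ : ℝ) (hκ : 0 < κ) :
    (∫ t, ‖𝓕 f t‖) ^ 2 ≤ ((∫ x : ℝ, ‖deriv (⇑f) x‖ ^ 2) + κ ^ 2 * (∫ x : ℝ, ‖f x‖ ^ 2)) / (2 * κ) := by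
  obtain ⟨hi, hI⟩ := inv_int κ hκ
  set A := ∫ t, ‖𝓕 f t‖ with hA
  have sqi : ∀ g : 𝓢(ℝ, ℂ), Integrable (fun t => ‖g t‖ ^ 2) := fun g =>
    (g.memLp 2).integrable_norm_pow (by norm_num)
  have hd : ∀ t, 𝓕 (SchwartzMap.derivCLM ℝ ℂ f) t = (2 * Real.pi * I * t) • 𝓕 f t := by
    intro t
    have h := Real.fourier_deriv f.integrable f.differentiable (by
      have := (SchwartzMap.derivCLM ℝ ℂ f).integrable (μ := volume)
      exact this)
    exact congrFun h t
  have hd2 : ∀ t, ‖𝓕 (SchwartzMap.derivCLM ℝ ℂ f) t‖ ^ 2 = (2 * Real.pi * t) ^ 2 * ‖𝓕 f t‖ ^ 2 := by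
    intro t
    rw [hd, norm_smul, mul_pow]
    congr 1
    simp [mul_pow]
  set Q := (∫ x : ℝ, ‖deriv (⇑f) x‖ ^ 2) + κ ^ 2 * (∫ x : ℝ, ‖f x‖ ^ 2) with hQ
  have hQ' : Q = ∫ t, (κ ^ 2 + (2 * Real.pi * t) ^ 2) * ‖𝓕 f t‖ ^ 2 := by
    have h1 := SchwartzMap.integral_norm_sq_fourier f
    have h2 := SchwartzMap.integral_norm_sq_fourier (SchwartzMap.derivCLM ℝ ℂ f)
    have h3 : ∫ x, ‖SchwartzMap.derivCLM ℝ ℂ f x‖ ^ 2 = ∫ x : ℝ, ‖deriv (⇑f) x‖ ^ 2 := rfl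
    rw [hQ, ← h3, ← h2, ← h1, ← integral_const_mul, ← integral_add (sqi _) ((sqi _).const_mul _)]
    congr 1
    ext t
    rw [hd2]; ring
  have hQi : Integrable fun t => (κ ^ 2 + (2 * Real.pi * t) ^ 2) * ‖𝓕 f t‖ ^ 2 := by
    have := (sqi (𝓕 (SchwartzMap.derivCLM ℝ ℂ f))).add ((sqi (𝓕 f)).const_mul (κ ^ 2))
    refine this.congr (Filter.Eventually.of_forall fun t => ?_)
    simp only [Pi.add_apply, hd2]; ring
  have hl : ∀ l : ℝ, 0 < l → A ≤ l / 2 * Q + 1 / (2 * l) * (1 / (2 * κ)) := by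
    intro l hl
    rw [hQ', ← hI, ← integral_const_mul, ← integral_const_mul, ← integral_add (hQi.const_mul _) (hi.const_mul _)]
    refine integral_mono (𝓕 f).integrable.norm ((hQi.const_mul _).add (hi.const_mul _)) fun t => ?_
    simp only
    have hp : 0 < κ ^ 2 + (2 * Real.pi * t) ^ 2 := by positivity
    set p := κ ^ 2 + (2 * Real.pi * t) ^ 2
    set y := ‖𝓕 f t‖
    have : l / 2 * (p * y ^ 2) + 1 / (2 * l) * p⁻¹ - y = (l * p * y - 1) ^ 2 / (2 * l * p) := by
      field_simp; ring
    have h2 : 0 ≤ (l * p * y - 1) ^ 2 / (2 * l * p) := by positivity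
    linarith
  have hA0 : 0 ≤ A := integral_nonneg fun t => norm_nonneg _
  have hQ0 : 0 ≤ Q := by
    rw [hQ']; exact integral_nonneg fun t => by positivity
  rcases hA0.eq_or_lt with h | h
  · rw [← h, zero_pow two_ne_zero]; exact div_nonneg hQ0 (by positivity)
  · have := hl (1 / (2 * κ * A)) (by positivity)
    rw [le_div_iff₀ (by positivity)]
    have h3 : 1 / (2 * κ * A) / 2 * Q + 1 / (2 * (1 / (2 * κ * A))) * (1 / (2 * κ)) = Q / (4 * κ * A) + A / 2 := by
      field_simp; ring
    rw [h3] at this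
    have h4 : A / 2 ≤ Q / (4 * κ * A) := by linarith
    rw [le_div_iff₀ (by positivity)] at h4
    nlinarith

lemma norm_toLp_sq' {F : ℝ → ℂ} (hF : MemLp F 2 volume) : ‖hF.toLp F‖ ^ 2 = ∫ x, ‖F x‖ ^ 2 := by
  rw [Lp.norm_toLp, hF.eLpNorm_eq_integral_rpow_norm (by norm_num) (by norm_num), ENNReal.toReal_ofReal (by positivity)]
  rw [← Real.rpow_natCast, ← Real.rpow_mul (by positivity)]
  simp

lemma N_memLp (u f : 𝓢(ℝ, ℂ)) :
    MemLp (fun x => u x * Pplus (fun y => (starRingEnd ℂ) (u y) * f y) x) 2 volume := by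
  have : (fun y => (starRingEnd ℂ) (u y) * f y) = cmul u f := by
    ext y; rw [cmul_apply]
  rw [this]
  obtain ⟨hc, C, hC⟩ := Pplus_bdd (cmul u f)
  have h1 : MemLp (Pplus (cmul u f)) ⊤ volume :=
    memLp_top_of_bound hc.aestronglyMeasurable C (Filter.Eventually.of_forall hC)
  exact h1.mul' (u.memLp 2)

lemma N_bound (u f : 𝓢(ℝ, ℂ)) :
    ‖(N_memLp u f).toLp _‖ ≤ 4 * (∫ ξ : ℝ, (1 + ξ ^ 2) ^ (1/4 : ℝ) * ‖FT (⇑u) ξ‖ ^ 2) * ∫ t, ‖𝓕 f t‖ := by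
  set S := ∫ ξ : ℝ, (1 + ξ ^ 2) ^ (1/4 : ℝ) * ‖FT (⇑u) ξ‖ ^ 2 with hS
  have hS0 : 0 ≤ S := integral_nonneg fun t => by positivity
  set A := ∫ t, ‖𝓕 f t‖ with hA
  have hA0 : 0 ≤ A := integral_nonneg fun t => norm_nonneg _
  set NL := (N_memLp u f).toLp _ with hNL
  have key : ∀ φ : 𝓢(ℝ, ℂ), ‖inner ℂ (φ.toLp 2 volume) NL‖ ≤ 4 * S * A * ‖φ.toLp 2 volume‖ := by
    intro φ
    have e1 : inner ℂ (φ.toLp 2 volume) NL =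
        ∫ x, (starRingEnd ℂ) (φ x) * (u x * Pplus (fun y => (starRingEnd ℂ) (u y) * f y) x) := by
      rw [L2.inner_def]
      apply integral_congr_ae
      filter_upwards [φ.coeFn_toLp 2 volume, (N_memLp u f).coeFn_toLp] with x h1 h2
      rw [h1, hNL, h2, RCLike.inner_apply, mul_comm]
    have e2 : (∫⁻ a, ‖𝓕 φ a‖ₑ ^ 2) ^ (1/2 : ℝ) = ENNReal.ofReal ‖φ.toLp 2 volume‖ := by
      have h1 : ‖φ.toLp 2 volume‖ ^ 2 = ∫ x, ‖𝓕 φ x‖ ^ 2 := by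
        rw [SchwartzMap.integral_norm_sq_fourier]
        exact norm_toLp_sq' (φ.memLp 2)
      have h2 : ∫⁻ a, ‖𝓕 φ a‖ₑ ^ 2 = ENNReal.ofReal (‖φ.toLp 2 volume‖ ^ 2) := by
        rw [h1, ofReal_integral_eq_lintegral_ofReal (((𝓕 φ).memLp 2).integrable_norm_pow (by norm_num))
          (Filter.Eventually.of_forall fun t => by positivity)]
        refine lintegral_congr fun t => ?_
        rw [ENNReal.ofReal_pow (norm_nonneg _), ofReal_norm]
      rw [h2, ENNReal.ofReal_rpow_of_nonneg (by positivity) (by norm_num), ← Real.rpow_natCast, ← Real.rpow_mul (norm_nonneg _)]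
      norm_num
    have e3 : ∫⁻ ζ, ‖𝓕 f ζ‖ₑ = ENNReal.ofReal A := by
      rw [hA, ofReal_integral_norm_eq_lintegral_enorm (𝓕 f).integrable]
    have hb := pair_bound u f φ
    rw [← e1, e2, e3] at hb
    have hb2 : ‖inner ℂ (φ.toLp 2 volume) NL‖ₑ ≤ ENNReal.ofReal (4 * S * A * ‖φ.toLp 2 volume‖) := by
      refine hb.trans ?_
      calc _ ≤ 4 * ENNReal.ofReal S * ENNReal.ofReal ‖φ.toLp 2 volume‖ * ENNReal.ofReal A := by
            gcongr
            exact S_bound u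
        _ = _ := by
            rw [show (4:ℝ≥0∞) = ENNReal.ofReal 4 by simp, ← ENNReal.ofReal_mul (by positivity),
              ← ENNReal.ofReal_mul (by positivity), ← ENNReal.ofReal_mul (by positivity)]
            congr 1; ring
    rw [← ofReal_norm] at hb2
    exact (ENNReal.ofReal_le_ofReal_iff (by positivity)).1 hb2
  have key2 : ∀ ψ : Lp ℂ 2 (volume : Measure ℝ), ‖inner ℂ ψ NL‖ ≤ 4 * S * A * ‖ψ‖ := by
    intro ψ
    have hd : DenseRange (SchwartzMap.toLpCLM ℝ ℂ 2 (volume : Measure ℝ)) :=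
      SchwartzMap.denseRange_toLpCLM (by norm_num)
    induction ψ using hd.induction_on with
    | hp => exact isClosed_le (by fun_prop) (by fun_prop)
    | ih φ => exact key φ
  have h := key2 NL
  rw [inner_self_eq_norm_sq_to_K] at h
  have h' : ‖NL‖ ^ 2 ≤ 4 * S * A * ‖NL‖ := by simpa using h
  rcases (norm_nonneg NL).eq_or_lt with h0 | h0
  · rw [← h0]; positivity
  · nlinarith

theorem lax_quadratic_form_comparable :
    ∃ C : ℝ, 1 ≤ C ∧ ∀ β : ℝ, (β = -1 ∨ β = 1) → ∀ u : SchwartzMap ℝ ℂ, ∀ κ : ℝ,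
      C * (1 + (∫ ξ : ℝ, (1 + ξ ^ 2) ^ (1/4 : ℝ) * ‖FT (⇑u) ξ‖ ^ 2) ^ (1/2 : ℝ)) ^ 4 ≤ κ →
      ∀ f : SchwartzMap ℝ ℂ,
        ((1/2 : ℝ) * ((∫ x : ℝ, ‖deriv (⇑f) x‖ ^ 2) + κ ^ 2 * (∫ x : ℝ, ‖f x‖ ^ 2)) ≤
            (∫ x : ℝ, ‖-Complex.I * deriv (⇑f) x +
                (β : ℂ) * u x * Pplus (fun y => (starRingEnd ℂ) (u y) * f y) x‖ ^ 2) +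
              κ ^ 2 * (∫ x : ℝ, ‖f x‖ ^ 2)) ∧
        ((∫ x : ℝ, ‖-Complex.I * deriv (⇑f) x +
              (β : ℂ) * u x * Pplus (fun y => (starRingEnd ℂ) (u y) * f y) x‖ ^ 2) +
            κ ^ 2 * (∫ x : ℝ, ‖f x‖ ^ 2) ≤
          (3/2 : ℝ) * ((∫ x : ℝ, ‖deriv (⇑f) x‖ ^ 2) + κ ^ 2 * (∫ x : ℝ, ‖f x‖ ^ 2))) := by
  refine ⟨400, by norm_num, fun β hβ u κ hκ f => ?_⟩
  have hN := N_bound u f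
  set S := ∫ ξ : ℝ, (1 + ξ ^ 2) ^ (1/4 : ℝ) * ‖FT (⇑u) ξ‖ ^ 2 with hS
  have hS0 : 0 ≤ S := integral_nonneg fun t => by positivity
  set s := S ^ (1/2 : ℝ) with hs
  have hs0 : 0 ≤ s := Real.rpow_nonneg hS0 _
  have hs2 : s ^ 2 = S := by
    rw [hs, ← Real.rpow_natCast, ← Real.rpow_mul hS0]; norm_num
  have hpow : s ^ 4 ≤ (1 + s) ^ 4 := by gcongr; linarith
  have hpow1 : 1 ≤ (1 + s) ^ 4 := one_le_pow₀ (by linarith)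
  have hκ0 : 0 < κ := by linarith
  have hSκ : 400 * S ^ 2 ≤ κ := by
    rw [← hs2, ← pow_mul]; norm_num; linarith
  have hL := L1_bound f κ hκ0
  set A := ∫ t, ‖𝓕 f t‖ with hA
  have hA0 : 0 ≤ A := integral_nonneg fun t => norm_nonneg _
  have ha : MemLp (fun x => -Complex.I * deriv (⇑f) x) 2 volume :=
    ((SchwartzMap.derivCLM ℝ ℂ f).memLp 2 volume).const_mul (-Complex.I)
  have hb := (N_memLp u f).const_mul (β : ℂ)
  have hx := norm_toLp_sq' ha
  have hy := norm_toLp_sq' hb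
  have hz := norm_toLp_sq' (ha.add hb)
  have hn := norm_toLp_sq' (N_memLp u f)
  have hbn : ‖(β : ℂ)‖ = 1 := by rcases hβ with h | h <;> simp [h]
  simp only [norm_mul, norm_neg, norm_I, one_mul, hbn] at hx hy
  simp only [← norm_mul] at hy
  rw [← hn] at hy
  have hzz : ∫ x, ‖((fun x => -Complex.I * deriv (⇑f) x) + fun x => (β : ℂ) * (u x * Pplus (fun y => (starRingEnd ℂ) (u y) * f y) x)) x‖ ^ 2
      = ∫ x : ℝ, ‖-Complex.I * deriv (⇑f) x +
              (β : ℂ) * u x * Pplus (fun y => (starRingEnd ℂ) (u y) * f y) x‖ ^ 2 := by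
    congr 1; ext x; simp only [Pi.add_apply, mul_assoc]
  rw [hzz] at hz
  rw [← hz]
  have t1 : ‖(ha.add hb).toLp _‖ ≤ ‖ha.toLp _‖ + ‖hb.toLp _‖ := by
    rw [MemLp.toLp_add]; exact norm_add_le _ _
  have t2 : ‖ha.toLp _‖ ≤ ‖(ha.add hb).toLp _‖ + ‖hb.toLp _‖ := by
    rw [MemLp.toLp_add ha hb]
    have := norm_sub_le (ha.toLp _ + hb.toLp _) (hb.toLp _)
    rwa [add_sub_cancel_right] at this
  rw [← hx] at hL ⊢
  have hF0 : 0 ≤ ∫ x : ℝ, ‖f x‖ ^ 2 := integral_nonneg fun t => by positivity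
  set x := ‖ha.toLp _‖
  set y := ‖hb.toLp _‖
  set z := ‖(ha.add hb).toLp _‖
  set n := ‖(N_memLp u f).toLp _‖
  have hx0 : 0 ≤ x := norm_nonneg _
  have hy0 : 0 ≤ y := norm_nonneg _
  have hz0 : 0 ≤ z := norm_nonneg _
  have hn0 : 0 ≤ n := norm_nonneg _
  set R := κ ^ 2 * ∫ x : ℝ, ‖f x‖ ^ 2
  have hR : 0 ≤ R := by positivity
  have hy2 : 50 * y ^ 2 ≤ x ^ 2 + R := by
    have h1 : n ^ 2 ≤ (4 * S * A) ^ 2 := by gcongr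
    have h2 : A ^ 2 * (2 * κ) ≤ x ^ 2 + R := (le_div_iff₀ (by positivity)).1 hL
    have h3 : A ^ 2 * (400 * S ^ 2) ≤ A ^ 2 * κ := by gcongr
    rw [hy]
    nlinarith
  constructor
  · have : x ^ 2 ≤ (z + y) ^ 2 := by gcongr
    nlinarith [sq_nonneg (z - 4 * y)]
  · have : z ^ 2 ≤ (x + y) ^ 2 := by gcongr
    nlinarith [sq_nonneg (x - 4 * y)]
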